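/- arXiv:1103.3390 — 3 statements merged into one kernel-verified Lean document; each statement's English description precedes it below -/
import Mathlib

section
/- If x̄ ∈ [0,1] is a cluster point of the sequence (xᵏ), then d_k(x̄) → 0 as k → ∞; that is, the lengths of the subdivision intervals containing x̄ tend to zero. -/
/-- Among the pairs of points of level `n` that enclose `y`, a pair of minimal distance has no
point of level `n` strictly between its members, so a lower bound for gaps containing `y` is a
lower bound for all enclosing pairs. -/
theorem le_sub_of_isLeast_gap {x : ℕ → ℝ} {y t : ℝ} {n i j : ℕ}
    (ht : IsLeast
      {t : ℝ | ∃ i ≤ n, ∃ j ≤ n, x i < x j ∧ x i ≤ y ∧ y ≤ x j ∧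
        (∀ l ≤ n, ¬ (x i < x l ∧ x l < x j)) ∧ t = x j - x i} t)
    (hi : i ≤ n) (hj : j ≤ n) (hij : x i < x j) (hiy : x i ≤ y) (hyj : y ≤ x j) :
    t ≤ x j - x i := by
  classical
  let S : Finset (ℕ × ℕ) :=
    (Finset.range (n + 1) ×ˢ Finset.range (n + 1)).filter
      (fun z => x z.1 < x z.2 ∧ x z.1 ≤ y ∧ y ≤ x z.2)
  have mem_S : ∀ a b, (a, b) ∈ S ↔ (a ≤ n ∧ b ≤ n) ∧ x a < x b ∧ x a ≤ y ∧ y ≤ x b := by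
    intro a b
    simp [S]
  have hmem : (i, j) ∈ S := (mem_S i j).2 ⟨⟨hi, hj⟩, hij, hiy, hyj⟩
  obtain ⟨⟨a, b⟩, hab, hmin⟩ := S.exists_min_image (fun z => x z.2 - x z.1) ⟨_, hmem⟩
  obtain ⟨⟨ha, hb⟩, hlt, hay, hyb⟩ := (mem_S a b).1 hab
  refine (ht.2 ⟨a, ha, b, hb, hlt, hay, hyb, ?_, rfl⟩).trans (hmin _ hmem)
  rintro l hl ⟨hal, hlb⟩
  rcases le_total (x l) y with h | h
  · have := hmin (l, b) ((mem_S l b).2 ⟨⟨hl, hb⟩, hlb, h, hyb⟩)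
    simp only at this
    linarith
  · have := hmin (a, l) ((mem_S a l).2 ⟨⟨ha, hl⟩, hal, hay, h⟩)
    simp only at this
    linarith

/-- If xbar is a cluster point of the trial sequence generated with the
α-splitting rule, then the lengths of the subdivision intervals containing
xbar tend to zero. -/
theorem stmt1 (α : ℝ) (hα₁ : 1/2 ≤ α) (hα₂ : α < 1)
    (x : ℕ → ℝ) (hx : ∀ k, x k ∈ Set.Icc (0:ℝ) 1)
    (hinj : Function.Injective x)
    (h0 : x 0 = 0) (h1 : x 1 = 1)
    (hin : ∀ k, 1 ≤ k → x (k+1) ∈ Set.Ioo (0:ℝ) 1)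
    (hsplit : ∀ k, 1 ≤ k → ∃ p q : ℝ,
      IsGreatest {y | ∃ i ≤ k, x i = y ∧ y < x (k+1)} p ∧
      IsLeast {y | ∃ i ≤ k, x i = y ∧ x (k+1) < y} q ∧
      max (q - x (k+1)) (x (k+1) - p) ≤ α * (q - p))
    (xbar : ℝ) (hxbar : xbar ∈ Set.Icc (0:ℝ) 1)
    (hcluster : MapClusterPt xbar Filter.atTop x)
    (d : ℕ → ℝ)
    (hd : ∀ k, 1 ≤ k → IsLeast
      {t : ℝ | ∃ i ≤ k, ∃ j ≤ k, x i < x j ∧ x i ≤ xbar ∧ xbar ≤ x j ∧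
        (∀ l ≤ k, ¬ (x i < x l ∧ x l < x j)) ∧ t = x j - x i} (d k)) :
    Filter.Tendsto d Filter.atTop (nhds 0) := by
  have hle : ∀ n, 1 ≤ n → ∀ i ≤ n, ∀ j ≤ n, x i < x j → x i ≤ xbar → xbar ≤ x j →
      d n ≤ x j - x i := fun n hn i hi j hj h₁ h₂ h₃ =>
    le_sub_of_isLeast_gap (hd n hn) hi hj h₁ h₂ h₃
  have hpos : ∀ n, 1 ≤ n → 0 < d n := by
    intro n hn
    obtain ⟨i, -, j, -, hij, -, -, -, h⟩ := (hd n hn).1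
    linarith
  have hanti : ∀ k n, 1 ≤ k → k ≤ n → d n ≤ d k := by
    intro k n hk hkn
    obtain ⟨i, hi, j, hj, hij, hix, hxj, -, h⟩ := (hd k hk).1
    rw [h]
    exact hle n (hk.trans hkn) i (hi.trans hkn) j (hj.trans hkn) hij hix hxj
  have hfreq := mapClusterPt_iff_frequently.1 hcluster
  have hcontract : ∀ k, 1 ≤ k → ∃ n, k ≤ n ∧ d n ≤ α * d k := by
    intro k hk
    by_cases htrial : ∃ m, x m = xbar
    · obtain ⟨m, hm⟩ := htrial
      have hε : 0 < α * d k := mul_pos (by linarith) (hpos k hk)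
      obtain ⟨n, hn, hxn⟩ :=
        Filter.frequently_atTop.1 (hfreq _ (Metric.ball_mem_nhds xbar hε)) (max k (m + 1))
      have hkn : k ≤ n := (le_max_left _ _).trans hn
      have hmn : m + 1 ≤ n := (le_max_right _ _).trans hn
      rw [Metric.mem_ball, Real.dist_eq, abs_lt] at hxn
      have hne : x n ≠ x m := fun h => by
        have := hinj h
        omega
      refine ⟨n, hkn, ?_⟩
      rcases lt_or_gt_of_ne hne with h | h
      · have := hle n (hk.trans hkn) n le_rfl m (by omega) h (by linarith) hm.ge
        linarith
      · have := hle n (hk.trans hkn) m (by omega) n le_rfl h hm.le (by linarith)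
        linarith
    · push Not at htrial
      obtain ⟨i, hi, j, hj, hij, hix, hxj, hgap, hdk⟩ := (hd k hk).1
      have hix' := lt_of_le_of_ne hix (htrial i)
      have hxj' := lt_of_le_of_ne hxj (htrial j).symm
      have hex : ∃ n, k ≤ n ∧ x i < x (n + 1) ∧ x (n + 1) < x j := by
        obtain ⟨n, hn, hxn⟩ :=
          Filter.frequently_atTop.1 (hfreq _ (Ioo_mem_nhds hix' hxj')) (k + 1)
        obtain ⟨m, rfl⟩ : ∃ m, n = m + 1 := ⟨n - 1, by omega⟩
        exact ⟨m, by omega, hxn.1, hxn.2⟩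
      classical
      obtain ⟨hkn, hin', hnj⟩ := Nat.find_spec hex
      have hmin := fun m => @Nat.find_min _ _ hex m
      generalize Nat.find hex = n at hkn hin' hnj hmin
      have hgap' : ∀ l ≤ n, ¬ (x i < x l ∧ x l < x j) := by
        intro l hl h
        rcases le_or_gt l k with hlk | hlk
        · exact hgap l hlk h
        · obtain ⟨m, rfl⟩ : ∃ m, l = m + 1 := ⟨l - 1, by omega⟩
          exact hmin m (by omega) ⟨by omega, h⟩
      obtain ⟨p, q, ⟨⟨a, ha, rfl, hap⟩, hp⟩, ⟨⟨b, hb, rfl, hbq⟩, hq⟩, hα⟩ :=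
        hsplit n (hk.trans hkn)
      have h₁ : x i ≤ x a := hp ⟨i, hi.trans hkn, rfl, hin'⟩
      have h₂ : x b ≤ x j := hq ⟨j, hj.trans hkn, rfl, hnj⟩
      have h₃ : x a = x i :=
        le_antisymm (not_lt.1 fun h => hgap' a ha ⟨h, hap.trans hnj⟩) h₁
      have h₄ : x b = x j :=
        le_antisymm h₂ (not_lt.1 fun h => hgap' b hb ⟨hin'.trans hbq, h⟩)
      rw [h₃, h₄, ← hdk, max_le_iff] at hα
      refine ⟨n + 1, by omega, ?_⟩
      rcases le_total (x (n + 1)) xbar with h | h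
      · exact (hle (n + 1) (by omega) (n + 1) le_rfl j (by omega) hnj h hxj).trans hα.1
      · exact (hle (n + 1) (by omega) i (by omega) (n + 1) le_rfl hin' hix h).trans hα.2
  have hpow : ∀ m : ℕ, ∃ n, 1 ≤ n ∧ d n ≤ α ^ m * d 1 := by
    intro m
    induction m with
    | zero => exact ⟨1, le_rfl, by simp⟩
    | succ m ih =>
      obtain ⟨k, hk, hkm⟩ := ih
      obtain ⟨n, hkn, hn⟩ := hcontract k hk
      refine ⟨n, hk.trans hkn, hn.trans ?_⟩
      rw [pow_succ', mul_assoc]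
      exact mul_le_mul_of_nonneg_left hkm (by linarith)
  have hlim : Filter.Tendsto (fun m : ℕ => α ^ m * d 1) Filter.atTop (nhds 0) := by
    simpa using (tendsto_pow_atTop_nhds_zero_of_lt_one (by linarith) hα₂).mul_const (d 1)
  rw [Metric.tendsto_atTop]
  intro ε hε
  obtain ⟨m, hm⟩ := (hlim.eventually_lt_const hε).exists
  obtain ⟨k, hk, hkm⟩ := hpow m
  refine ⟨k, fun n hn => ?_⟩
  rw [Real.dist_eq, sub_zero, abs_of_pos (hpos n (hk.trans hn))]
  exact (hanti k n hk hn).trans_lt (hkm.trans_lt hm)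
end

section
/- Then x₀ < x' < x₁ and max{x₁ − x', x' − x₀} ≤ ((r+1)/(2r))·(x₁ − x₀); in particular the new trial point x' splits the interval [x₀, x₁] into two parts whose lengths are at most the fixed fraction α = (r+1)/(2r) < 1 of the length of [x₀, x₁]. -/
/-- The new trial point lies strictly inside the interval and splits it into
two parts of length at most the fraction (r+1)/(2r) < 1 of the interval. -/
theorem stmt2 (N : ℕ) (hN : 1 ≤ N) (x₀ x₁ z₀ z₁ M r x' : ℝ)
    (hx : x₀ < x₁) (hM : 0 < M) (hr : 1 < r)
    (hz : |z₁ - z₀| ^ N ≤ M ^ N * (x₁ - x₀))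
    (hx' : x' = (x₁ + x₀) / 2 -
      Real.sign (z₁ - z₀) * |z₁ - z₀| ^ N / (2 * r * M ^ N)) :
    x₀ < x' ∧ x' < x₁ ∧
    max (x₁ - x') (x' - x₀) ≤ (r + 1) / (2 * r) * (x₁ - x₀) ∧
    (r + 1) / (2 * r) < 1 := by
  have hr₀ : 0 < r := by linarith
  have hMN : 0 < M ^ N := pow_pos hM N
  have hsign : |Real.sign (z₁ - z₀)| ≤ 1 := by
    rcases Real.sign_apply_eq (z₁ - z₀) with h | h | h <;> simp [h]
  have hshift : |Real.sign (z₁ - z₀) * |z₁ - z₀| ^ N / (2 * r * M ^ N)| ≤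
      (x₁ - x₀) / (2 * r) := by
    rw [abs_div, abs_mul, abs_of_pos (by positivity : 0 < 2 * r * M ^ N),
      abs_of_nonneg (by positivity : 0 ≤ |z₁ - z₀| ^ N)]
    calc |Real.sign (z₁ - z₀)| * |z₁ - z₀| ^ N / (2 * r * M ^ N)
        ≤ 1 * (M ^ N * (x₁ - x₀)) / (2 * r * M ^ N) := by gcongr
      _ = (x₁ - x₀) / (2 * r) := by field_simp
  obtain ⟨hlower, hupper⟩ := abs_le.mp hshift
  have hlt : (x₁ - x₀) / (2 * r) < (x₁ - x₀) / 2 :=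
    div_lt_div_of_pos_left (by linarith) (by norm_num) (by linarith)
  have hsplit : (r + 1) / (2 * r) * (x₁ - x₀) =
      (x₁ - x₀) / 2 + (x₁ - x₀) / (2 * r) := by
    field_simp
  refine ⟨by linarith, by linarith, max_le (by linarith) (by linarith), ?_⟩
  rw [div_lt_one (by positivity)]
  linarith
end

section
/- If r·M > 2^{1−1/N}·C + √(2^{2−2/N}·C² − D²), then R > 0 (the quantity under the square root is nonnegative, since D ≤ C ≤ 2^{1−1/N}·C for N ≥ 2). -/
/-- The power mean inequality for two nonnegative reals and an exponent in `[0, 1]`. -/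
theorem Real.rpow_add_rpow_le_two_rpow_mul {a b p : ℝ} (ha : 0 ≤ a) (hb : 0 ≤ b)
    (hp₀ : 0 ≤ p) (hp₁ : p ≤ 1) :
    a ^ p + b ^ p ≤ (2:ℝ) ^ (1 - p) * (a + b) ^ p := by
  have h := (Real.concaveOn_rpow hp₀ hp₁).2 (Set.mem_Ici.2 ha) (Set.mem_Ici.2 hb)
    (by norm_num : (0:ℝ) ≤ 1 / 2) (by norm_num : (0:ℝ) ≤ 1 / 2) (by norm_num)
  simp only [smul_eq_mul] at h
  have hmid : (1 / 2 * a + 1 / 2 * b) ^ p = (a + b) ^ p / (2:ℝ) ^ p := by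
    rw [← Real.div_rpow (by positivity) (by norm_num)]
    congr 1
    ring
  rw [hmid] at h
  rw [Real.rpow_sub (by norm_num), Real.rpow_one]
  calc a ^ p + b ^ p = 2 * (1 / 2 * a ^ p + 1 / 2 * b ^ p) := by ring
    _ ≤ 2 * ((a + b) ^ p / (2:ℝ) ^ p) := by gcongr
    _ = 2 / (2:ℝ) ^ p * (a + b) ^ p := by ring


/-- If rM exceeds 2^{1-1/N}C + √(2^{2-2/N}C² − D²) then the characteristic R
is positive; moreover the quantity under the square root is nonnegative. -/
theorem stmt7 (N : ℕ) (hN : 2 ≤ N) (r M C x₀ x₁ xstar z₀ z₁ Δ D R : ℝ)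
    (hr : 0 < r) (hM : 0 < M) (hC : 0 ≤ C)
    (hx : x₀ < x₁) (hxs : xstar ∈ Set.Icc x₀ x₁)
    (hΔ : Δ = (x₁ - x₀) ^ (1 / (N:ℝ)))
    (hz₀ : 0 ≤ z₀) (hz₁ : 0 ≤ z₁)
    (hz₀C : z₀ ≤ C * (xstar - x₀) ^ (1 / (N:ℝ)))
    (hz₁C : z₁ ≤ C * (x₁ - xstar) ^ (1 / (N:ℝ)))
    (hD : D = |z₁ - z₀| / Δ)
    (hR : R = Δ + (z₁ - z₀) ^ 2 / ((r * M) ^ 2 * Δ) - 2 * (z₁ + z₀) / (r * M))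
    (hcond : r * M > (2:ℝ) ^ (1 - 1 / (N:ℝ)) * C +
      Real.sqrt ((2:ℝ) ^ (2 - 2 / (N:ℝ)) * C ^ 2 - D ^ 2)) :
    0 ≤ (2:ℝ) ^ (2 - 2 / (N:ℝ)) * C ^ 2 - D ^ 2 ∧ 0 < R := by
  obtain ⟨hl, hu⟩ := hxs
  have hΔpos : 0 < Δ := hΔ ▸ Real.rpow_pos_of_pos (sub_pos.2 hx) _
  have hN1 : (1:ℝ) ≤ N := by exact_mod_cast (by omega : 1 ≤ N)
  have hmean := Real.rpow_add_rpow_le_two_rpow_mul (sub_nonneg.2 hl) (sub_nonneg.2 hu)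
    (by positivity : 0 ≤ 1 / (N:ℝ)) ((div_le_one (by positivity)).2 hN1)
  rw [show xstar - x₀ + (x₁ - xstar) = x₁ - x₀ by ring, ← hΔ] at hmean
  have hsq : (2:ℝ) ^ (2 - 2 / (N:ℝ)) * C ^ 2 = ((2:ℝ) ^ (1 - 1 / (N:ℝ)) * C) ^ 2 := by
    rw [mul_pow, ← Real.rpow_mul_natCast (by norm_num)]
    congr 2
    push_cast
    ring
  rw [hsq] at hcond ⊢
  have hsum : z₁ + z₀ ≤ (2:ℝ) ^ (1 - 1 / (N:ℝ)) * C * Δ := by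
    linarith [mul_le_mul_of_nonneg_left hmean hC]
  have hK : 0 ≤ (2:ℝ) ^ (1 - 1 / (N:ℝ)) * C := by positivity
  set K := (2:ℝ) ^ (1 - 1 / (N:ℝ)) * C
  have hD0 : 0 ≤ D := hD ▸ by positivity
  have hDK : D ≤ K := by
    rw [hD, div_le_iff₀ hΔpos]
    exact (abs_le.2 ⟨by linarith, by linarith⟩ : |z₁ - z₀| ≤ z₁ + z₀).trans hsum
  have hnonneg : 0 ≤ K ^ 2 - D ^ 2 := sub_nonneg.2 (pow_le_pow_left₀ hD0 hDK 2)
  refine ⟨hnonneg, ?_⟩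
  have hm : 0 < r * M := mul_pos hr hM
  set m := r * M
  have hroot : K ^ 2 - D ^ 2 < (m - K) ^ 2 :=
    (Real.sqrt_lt' (by linarith [Real.sqrt_nonneg (K ^ 2 - D ^ 2)])).1 (by linarith)
  have hdiff : (z₁ - z₀) ^ 2 = (D * Δ) ^ 2 := by
    rw [hD, div_mul_cancel₀ _ hΔpos.ne', sq_abs]
  have hform : R = (Δ * (m ^ 2 + D ^ 2) - 2 * (z₁ + z₀) * m) / m ^ 2 := by
    rw [hR, hdiff]
    field_simp
  rw [hform]
  apply div_pos _ (by positivity)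
  have hpos : 0 < Δ * (m ^ 2 + D ^ 2 - 2 * K * m) := mul_pos hΔpos (by linarith)
  linarith [mul_le_mul_of_nonneg_right hsum hm.le]
end
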